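/- Let d, n, m ≥ 1 with m ≤ n, and let A = (a_1, …, a_n) and B = (b_1, …, b_m) be sequences of vectors in {0,1}^d. Let w = (d²+4d+1)(2m−1)+d+1. If there is no pair (a_i, b_j) with a_i and b_j orthogonal, then every substring T of S' such that P' is a subsequence of T has length at least w−2d. -/

import Mathlib

/- Binary strings are lists of Booleans: `false` is the character 0 and
`true` is the character 1. -/

/-- The coordinate gadget: s(a[i]) = 01 if a[i] = 0, and 00 if a[i] = 1. -/
def coordGadget (v : Bool) : List Bool :=
  if v then [false, false] else [false, true]

/-- The inner separator gadget 0^d. -/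
def innerSep (d : ℕ) : List Bool := List.replicate d false

/-- The outer separator gadget 1^(d+1). -/
def outerSep (d : ℕ) : List Bool := List.replicate (d + 1) true

/-- p'(b) = 0^d b[1] 0^d b[2] 0^d ⋯ 0^d b[d] 0^d. -/
def pStr' {d : ℕ} (b : Fin d → Bool) : List Bool :=
  innerSep d ++ (List.ofFn fun i => [b i] ++ innerSep d).flatten

/-- s'(a) = 0^d s(a[1]) 0^d s(a[2]) 0^d ⋯ 0^d s(a[d]) 0^d. -/
def sStr' {d : ℕ} (a : Fin d → Bool) : List Bool :=
  innerSep d ++ (List.ofFn fun i => coordGadget (a i) ++ innerSep d).flatten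

/-- The all-zeros vector z ∈ {0,1}^d. -/
def zVec (d : ℕ) : Fin d → Bool := fun _ => false

/-- Two vectors a, b ∈ {0,1}^d are orthogonal if a[i]·b[i] = 0 for all i. -/
def Orthogonal {d : ℕ} (a b : Fin d → Bool) : Prop :=
  ∀ i, (a i && b i) = false

/-- The pattern P' = 1^(d+1) p'(b₁) 1^(d+1) p'(b₂) 1^(d+1) ⋯ 1^(d+1) p'(bₘ) 1^(d+1). -/
def Pstr' {d m : ℕ} (B : Fin m → Fin d → Bool) : List Bool :=
  outerSep d ++ (List.ofFn fun j => pStr' (B j) ++ outerSep d).flatten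

/-- One copy of the concatenation
s'(a₁) 1^(d+1) s'(z) 1^(d+1) ⋯ s'(aₙ) 1^(d+1) s'(z) 1^(d+1). -/
def Shalf' {d n : ℕ} (A : Fin n → Fin d → Bool) : List Bool :=
  (List.ofFn fun i =>
    sStr' (A i) ++ outerSep d ++ sStr' (zVec d) ++ outerSep d).flatten

/-- The text S' = 1^(d+1) s'(z) 1^(d+1) followed by two consecutive copies of
s'(a₁) 1^(d+1) s'(z) 1^(d+1) ⋯ s'(aₙ) 1^(d+1) s'(z) 1^(d+1). -/
def Sstr' {d n : ℕ} (A : Fin n → Fin d → Bool) : List Bool :=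
  outerSep d ++ sStr' (zVec d) ++ outerSep d ++ Shalf' A ++ Shalf' A

namespace SubstringLowerBound

open List

theorem cons_sublist_of_sublist_replicate_append {α : Type*} {a b : α} (hab : a ≠ b)
    {l r : List α} (t : ℕ) (h : (a :: l).Sublist (replicate t b ++ r)) :
    (a :: l).Sublist r := by
  induction t with
  | zero => simpa using h
  | succ t ih =>
    rw [replicate_succ, cons_append] at h
    cases h with
    | cons _ h => exact ih h
    | cons_cons _ h => exact absurd rfl hab

theorem concat_sublist_of_sublist_append_replicate {α : Type*} {a b : α} (hab : a ≠ b)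
    {l r : List α} (t : ℕ) (h : (l ++ [a]).Sublist (r ++ replicate t b)) :
    (l ++ [a]).Sublist r := by
  rw [← reverse_sublist] at h ⊢
  simp only [reverse_append, reverse_replicate, reverse_cons, reverse_nil, nil_append,
    singleton_append] at h ⊢
  exact cons_sublist_of_sublist_replicate_append hab t h

theorem prefix_append_cases {α : Type*} {T u v : List α} (h : T <+: u ++ v) :
    T <+: u ∨ ∃ T', T = u ++ T' ∧ T' <+: v := by
  obtain ⟨s, hs⟩ := h
  rcases append_eq_append_iff.1 hs with ⟨c, h1, h2⟩ | ⟨c, h1, h2⟩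
  · exact .inl ⟨c, h1.symm⟩
  · exact .inr ⟨c, h1, s, h2.symm⟩

theorem append_sublist_append_cases {α : Type*} {p q u v : List α}
    (h : (p ++ q).Sublist (u ++ v)) :
    (∃ c c', q = c ++ c' ∧ (p ++ c).Sublist u ∧ c'.Sublist v) ∨ q.Sublist v := by
  obtain ⟨M, N, h1, h2, h3⟩ := sublist_append_iff.1 h
  rcases append_eq_append_iff.1 h1 with ⟨c, h4, h5⟩ | ⟨c, h4, h5⟩
  · exact .inl ⟨c, N, h5, h4 ▸ h2, h3⟩
  · exact .inr ((h5 ▸ sublist_append_right c q).trans h3)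

theorem innerSep_append_flatMap_comm {α : Type*} (d : ℕ) (f : α → List Bool) (l : List α) :
    innerSep d ++ l.flatMap (fun x => f x ++ innerSep d) =
      l.flatMap (fun x => innerSep d ++ f x) ++ innerSep d := by
  induction l with
  | nil => simp
  | cons x l ih => simp [ih]

theorem length_flatMap_of_length_eq {α β : Type*} {f : α → List β} {k : ℕ}
    (hf : ∀ x, (f x).length = k) (l : List α) : (l.flatMap f).length = l.length * k := by
  induction l with
  | nil => simp
  | cons x l ih => simp only [flatMap_cons, length_append, hf, ih, length_cons]; ring

theorem length_coordGadget (v : Bool) : (coordGadget v).length = 2 := by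
  cases v <;> rfl

theorem pStr'_eq {d : ℕ} (b : Fin d → Bool) :
    pStr' b = innerSep d ++ (ofFn b).flatMap (fun x => [x] ++ innerSep d) := by
  simp [pStr', flatMap_def, map_ofFn, Function.comp_def]

theorem sStr'_eq {d : ℕ} (a : Fin d → Bool) :
    sStr' a = innerSep d ++ (ofFn a).flatMap (fun x => coordGadget x ++ innerSep d) := by
  simp [sStr', flatMap_def, map_ofFn, Function.comp_def]

theorem length_sStr' {d : ℕ} (a : Fin d → Bool) : (sStr' a).length = d ^ 2 + 3 * d := by
  rw [sStr'_eq, length_append, length_flatMap_of_length_eq (k := d + 2)]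
  · simp [innerSep]; ring
  · intro x; simp [length_coordGadget, innerSep]; ring

theorem count_true_sStr'_le {d : ℕ} (a : Fin d → Bool) : (sStr' a).count true ≤ d := by
  have key : ∀ l : List Bool,
      (l.flatMap (fun x => coordGadget x ++ innerSep d)).count true ≤ l.length := by
    intro l
    induction l with
    | nil => simp
    | cons x l ih =>
      have : (coordGadget x).count true ≤ 1 := by cases x <;> decide
      have : (innerSep d).count true = 0 := by
        rw [innerSep, count_replicate]; rfl
      simp only [flatMap_cons, count_append, length_cons]
      omega
  have : (innerSep d).count true = 0 := by
    rw [innerSep, count_replicate]; rfl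
  have := key (ofFn a)
  rw [length_ofFn] at this
  rw [sStr'_eq, count_append]
  omega

theorem ofFn_eq_take_append_cons_drop {α : Type*} {d : ℕ} (f : Fin d → α) (i : Fin d) :
    ofFn f = (ofFn f).take i ++ f i :: (ofFn f).drop (i + 1) := by
  have h : (i : ℕ) < (ofFn f).length := by simp
  conv_lhs => rw [← take_append_drop i (ofFn f), drop_eq_getElem_cons h]
  simp

theorem not_sublist_of_not_orthogonal {d : ℕ} {a b : Fin d → Bool} (h : ¬ Orthogonal a b) :
    ¬ (pStr' b).Sublist (sStr' a) := by
  intro hs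
  simp only [Orthogonal, not_forall, Bool.not_eq_false, Bool.and_eq_true] at h
  obtain ⟨i, hai, hbi⟩ := h
  rw [pStr'_eq, sStr'_eq, ofFn_eq_take_append_cons_drop a i,
    ofFn_eq_take_append_cons_drop b i, hai, hbi] at hs
  have hi := i.isLt
  have l1 : ((ofFn a).take i).length = i := by simp
  have l2 : ((ofFn b).take i).length = i := by simp
  have l3 : ((ofFn a).drop (i + 1)).length = d - (i + 1) := by simp
  have l4 : ((ofFn b).drop (i + 1)).length = d - (i + 1) := by simp
  generalize (ofFn a).take i = a₁ at *
  generalize (ofFn b).take i = b₁ at *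
  generalize (ofFn a).drop (i + 1) = a₂ at *
  generalize (ofFn b).drop (i + 1) = b₂ at *
  have hs' : ((innerSep d ++ b₁.flatMap (fun x => [x] ++ innerSep d)) ++
      true :: (innerSep d ++ b₂.flatMap (fun x => [x] ++ innerSep d))).Sublist
      ((a₁.flatMap (fun x => innerSep d ++ coordGadget x) ++ replicate (d + 2) false) ++
        (replicate d false ++ a₂.flatMap (fun x => coordGadget x ++ innerSep d))) := by
    have e : replicate (d + 2) false = innerSep d ++ [false, false] := by
      simp [innerSep, replicate_add]
    rw [e, ← append_assoc (a₁.flatMap _), ← innerSep_append_flatMap_comm]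
    simpa [coordGadget, innerSep] using hs
  have lp : ∀ x : Bool, ([x] ++ innerSep d).length = d + 1 := by intro x; simp [innerSep]
  have ls : ∀ x : Bool, (coordGadget x ++ innerSep d).length = d + 2 := by
    intro x; simp [innerSep, length_coordGadget]; ring
  have ls' : ∀ x : Bool, (innerSep d ++ coordGadget x).length = d + 2 := by
    intro x; simp [innerSep, length_coordGadget]
  obtain ⟨k, hk⟩ : ∃ k, d = i + 1 + k := ⟨d - (i + 1), by omega⟩
  have l5 : d - (i + 1) = k := by omega
  have right : ¬ (true :: (innerSep d ++ b₂.flatMap (fun x => [x] ++ innerSep d))).Sublist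
      (replicate d false ++ a₂.flatMap (fun x => coordGadget x ++ innerSep d)) := by
    intro hr
    have := (cons_sublist_of_sublist_replicate_append (by decide) d hr).length_le
    rw [length_cons, length_append, length_flatMap_of_length_eq lp,
      length_flatMap_of_length_eq ls, l3, l4, l5] at this
    simp only [innerSep, length_replicate] at this
    have : k * (d + 2) = k * (d + 1) + k := by ring
    omega
  rcases append_sublist_append_cases hs' with ⟨c, c', hc, hl, hr⟩ | hr
  · cases c with
    | nil => exact right (hc ▸ hr)
    | cons x c =>
      obtain ⟨rfl, -⟩ := cons.inj hc
      have hl' := ((prefix_append _ c).sublist.trans (by simpa using hl) :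
        ((innerSep d ++ b₁.flatMap (fun x => [x] ++ innerSep d)) ++ [true]).Sublist
        (a₁.flatMap (fun x => innerSep d ++ coordGadget x) ++ replicate (d + 2) false))
      have := (concat_sublist_of_sublist_append_replicate (by decide) _ hl').length_le
      simp only [length_append, length_flatMap_of_length_eq lp, length_singleton,
        length_flatMap_of_length_eq ls', l1, l2] at this
      simp only [innerSep, length_replicate] at this
      have : (i : ℕ) * (d + 2) = i * (d + 1) + i := by ring
      omega
  · exact right hr

theorem pStr'_head {d : ℕ} (hd : 1 ≤ d) (b : Fin d → Bool) : ∃ q, pStr' b = false :: q := by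
  obtain ⟨d, rfl⟩ : ∃ e, d = e + 1 := ⟨d - 1, by omega⟩
  exact ⟨_, by rw [pStr', innerSep, replicate_succ, cons_append]⟩

theorem pStr'_last {d : ℕ} (hd : 1 ≤ d) (b : Fin d → Bool) : ∃ q, pStr' b = q ++ [false] := by
  obtain ⟨d, rfl⟩ : ∃ e, d = e + 1 := ⟨d - 1, by omega⟩
  rw [pStr'_eq, innerSep_append_flatMap_comm]
  exact ⟨_, by rw [innerSep, replicate_succ', ← append_assoc]⟩

/-- A separator of the pattern cannot be matched before the next separator of the text begins. -/
theorem outerSep_append_sublist {d t : ℕ} {g R T Q : List Bool}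
    (hg : g.count true ≤ d) (hQ : Q = [] ∨ ∃ q, Q = false :: q)
    (hT : T <+: g ++ (replicate t true ++ R)) (hs : (outerSep d ++ Q).Sublist T) :
    (Q = [] ∧ g.length + 1 ≤ T.length) ∨
      ∃ T', T = g ++ (replicate t true ++ T') ∧ T' <+: R ∧ Q.Sublist T' := by
  have hsep : ¬ (outerSep d).Sublist g := fun h => by
    have := h.count_le true
    simp only [outerSep, count_replicate_self] at this
    omega
  have hfalse : ∀ s c, ¬ (outerSep d ++ false :: c).Sublist (g ++ replicate s true) := by
    intro s c h
    have h' : (outerSep d ++ [false]).Sublist (g ++ replicate s true) :=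
      (prefix_append _ c).sublist.trans (by simpa using h)
    exact hsep ((sublist_append_left _ _).trans
      (concat_sublist_of_sublist_append_replicate (by decide) s h'))
  rcases prefix_append_cases hT with hT | ⟨T', rfl, hT'⟩
  · exact absurd ((sublist_append_left _ _).trans (hs.trans hT.sublist)) hsep
  rcases prefix_append_cases hT' with hT' | ⟨T'', rfl, hT''⟩
  · left
    obtain ⟨s, -, rfl⟩ : ∃ s, s ≤ t ∧ T' = replicate s true := by
      exact ⟨_, prefix_replicate_iff.1 hT'⟩
    rcases hQ with rfl | ⟨q, rfl⟩
    · refine ⟨rfl, ?_⟩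
      rcases s with _ | s
      · exact absurd (by simpa using hs) hsep
      · simp
    · exact absurd hs (hfalse s q)
  · right
    refine ⟨T'', rfl, hT'', ?_⟩
    rw [← append_assoc] at hs
    rcases append_sublist_append_cases hs with ⟨c, c', hc, hl, hr⟩ | hr
    · cases c with
      | nil => simpa [hc] using hr
      | cons x c =>
        rcases hQ with rfl | ⟨q, rfl⟩
        · simp at hc
        · obtain ⟨rfl, -⟩ := cons.inj hc
          exact absurd hl (hfalse t c)
    · exact hr

/-- A pattern gadget that does not fit into the current text gadget goes past the separator. -/
theorem append_sublist_of_not_sublist {t : ℕ} {p g R T Q : List Bool}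
    (hp : ∃ q, p = q ++ [false]) (hpg : ¬ p.Sublist g)
    (hT : T <+: g ++ (replicate t true ++ R)) (hs : (p ++ Q).Sublist T) :
    ∃ T', T = g ++ (replicate t true ++ T') ∧ T' <+: R ∧ Q.Sublist T' := by
  have hpg' : ¬ p.Sublist (g ++ replicate t true) := by
    obtain ⟨q, rfl⟩ := hp
    exact fun h => hpg (concat_sublist_of_sublist_append_replicate (by decide) t h)
  rw [← append_assoc] at hT
  rcases prefix_append_cases hT with hT | ⟨T', rfl, hT'⟩
  · exact absurd ((sublist_append_left _ _).trans (hs.trans hT.sublist)) hpg'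
  refine ⟨T', append_assoc _ _ _, hT', ?_⟩
  rcases append_sublist_append_cases hs with ⟨c, c', -, hl, -⟩ | hr
  · exact absurd ((sublist_append_left _ _).trans hl) hpg'
  · exact hr

/-- Gadgets of length `k` with at most `d` ones, such that every second one (starting with the
first one if `c` holds) contains no string of `Ps` as a subsequence. -/
def IsAlternating (d k : ℕ) (Ps : Set (List Bool)) : Bool → List (List Bool) → Prop
  | _, [] => True
  | c, g :: G => g.length = k ∧ g.count true ≤ d ∧ (c = true → ∀ p ∈ Ps, ¬ p.Sublist g) ∧
      IsAlternating d k Ps (!c) G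

theorem length_lower_bound_of_prefix {d k : ℕ} {Ps : Set (List Bool)}
    (hhead : ∀ p ∈ Ps, ∃ q, p = false :: q) (hlast : ∀ p ∈ Ps, ∃ q, p = q ++ [false])
    (L : List (List Bool)) (hL : ∀ p ∈ L, p ∈ Ps) (hne : L ≠ []) (c : Bool)
    (G : List (List Bool)) (hG : IsAlternating d k Ps c G) (T : List Bool)
    (hT : T <+: G.flatMap (· ++ outerSep d)) (hs : (L.flatMap (· ++ outerSep d)).Sublist T) :
    2 * L.length * (k + d + 1) ≤ T.length + d + (if c then 0 else k + d + 1) := by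
  induction L generalizing c G T with
  | nil => exact absurd rfl hne
  | cons p L ih =>
    have hpP := hL p (by simp)
    have hL' : ∀ p ∈ L, p ∈ Ps := fun q hq => hL q (by simp [hq])
    have hQ : L.flatMap (· ++ outerSep d) = [] ∨
        ∃ q, L.flatMap (· ++ outerSep d) = false :: q := by
      cases L with
      | nil => exact .inl rfl
      | cons p' L =>
        obtain ⟨q, hq⟩ := hhead p' (hL' p' (by simp))
        exact .inr ⟨_, by rw [flatMap_cons, hq, cons_append, cons_append]⟩
    have hQnil : L.flatMap (· ++ outerSep d) = [] → L = [] := by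
      intro h
      cases L with
      | nil => rfl
      | cons p' L => simp [outerSep] at h
    have hstep : 2 * (p :: L).length * (k + d + 1) =
        2 * L.length * (k + d + 1) + 2 * (k + d + 1) := by rw [length_cons]; ring
    rw [hstep]
    rw [flatMap_cons, append_assoc] at hs
    have hempty : ∀ q, ¬ (q ++ (outerSep d ++ L.flatMap (· ++ outerSep d))).Sublist [] := by
      intro q h
      simp [outerSep] at h
    rcases G with _ | ⟨g, G⟩
    · rw [flatMap_nil, prefix_nil] at hT
      exact absurd (hT ▸ hs) (hempty p)
    obtain ⟨hgl, hgc, hgb, hG⟩ := hG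
    rw [flatMap_cons, append_assoc, outerSep] at hT
    by_cases hpg : p.Sublist g
    · have hc : c = false := by
        by_contra hc
        exact hgb (by simpa using hc) p hpP hpg
      subst hc
      rcases outerSep_append_sublist hgc hQ hT ((sublist_append_right _ _).trans hs)
        with ⟨h1, h2⟩ | ⟨T', rfl, h1, h2⟩
      · simp [hQnil h1]
        omega
      · by_cases hLn : L = []
        · simp [hLn]; omega
        · have := ih hL' hLn _ G hG T' h1 h2
          simp at this ⊢
          omega
    · obtain ⟨T', rfl, h1, h2⟩ := append_sublist_of_not_sublist (hlast p hpP) hpg hT hs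
      rcases G with _ | ⟨g', G⟩
      · rw [flatMap_nil, prefix_nil] at h1
        rw [h1] at h2
        exact absurd h2 (hempty [])
      obtain ⟨hgl', hgc', -, hG⟩ := hG
      have h1 : T' <+: g' ++ (replicate (d + 1) true ++ G.flatMap (· ++ outerSep d)) := by
        rwa [flatMap_cons, append_assoc] at h1
      rcases outerSep_append_sublist hgc' hQ h1 h2 with ⟨h3, h4⟩ | ⟨T'', rfl, h3, h4⟩
      · simp [hQnil h3]
        omega
      · by_cases hLn : L = []
        · simp [hLn]; omega
        · have := ih hL' hLn _ G hG T'' h3 h4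
          simp at this ⊢
          omega

theorem suffix_append_cases {α : Type*} {T u v : List α} (h : T <:+ u ++ v) :
    T <:+ v ∨ ∃ T', T = T' ++ v ∧ T' <:+ u := by
  obtain ⟨s, hs⟩ := h
  rcases append_eq_append_iff.1 hs with ⟨c, h1, h2⟩ | ⟨c, h1, h2⟩
  · exact .inr ⟨c, h2, s, h1.symm⟩
  · exact .inl ⟨c, h2.symm⟩

theorem suffix_flatMap_cases {d k : ℕ} {Ps : Set (List Bool)} (G : List (List Bool)) (c : Bool)
    (hG : IsAlternating d k Ps c G) (t : ℕ) (ht : 1 ≤ t) (g X : List Bool)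
    (hg : g.count true ≤ d)
    (hX : X <:+ g ++ (replicate t true ++ G.flatMap (· ++ outerSep d))) :
    X = [] ∨ ∃ g' t' c' G', g'.count true ≤ d ∧ 1 ≤ t' ∧
      IsAlternating d k Ps c' G' ∧
      X = g' ++ (replicate t' true ++ G'.flatMap (· ++ outerSep d)) := by
  have hfirst : X <:+ G.flatMap (· ++ outerSep d) ∨
      ∃ g' t', g'.count true ≤ d ∧ 1 ≤ t' ∧
        X = g' ++ (replicate t' true ++ G.flatMap (· ++ outerSep d)) := by
    rcases suffix_append_cases hX with hX | ⟨g', rfl, hg'⟩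
    · rcases suffix_append_cases hX with hX | ⟨X', rfl, hX'⟩
      · exact .inl hX
      · obtain ⟨-, hX'⟩ := suffix_replicate_iff.1 hX'
        rcases Nat.eq_zero_or_pos X'.length with h0 | h0
        · rw [length_eq_zero_iff.1 h0]
          exact .inl suffix_rfl
        · exact .inr ⟨[], X'.length, by simp, h0, by rw [← hX', nil_append]⟩
    · exact .inr ⟨g', t, (hg'.sublist.count_le _).trans hg, ht, rfl⟩
  rcases hfirst with hX | ⟨g', t', h1, h2, h3⟩
  · cases G with
    | nil => exact .inl (by simpa using hX)
    | cons g₁ G =>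
      obtain ⟨-, hc, -, hG⟩ := hG
      rw [flatMap_cons, append_assoc] at hX
      exact suffix_flatMap_cases G (!c) hG (d + 1) (by omega) g₁ X hc hX
  · exact .inr ⟨g', t', c, G, h1, h2, hG, h3⟩

theorem isAlternating_flatMap_append {α : Type*} {d k : ℕ} {Ps : Set (List Bool)}
    {f : α → List Bool} {z : List Bool} {H : List (List Bool)}
    (hf : ∀ a, (f a).length = k ∧ (f a).count true ≤ d)
    (hz : z.length = k ∧ z.count true ≤ d) (l : List α)
    (hl : ∀ a ∈ l, ∀ p ∈ Ps, ¬ p.Sublist (f a)) (hH : IsAlternating d k Ps true H) :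
    IsAlternating d k Ps true (l.flatMap (fun a => [f a, z]) ++ H) := by
  induction l with
  | nil => exact hH
  | cons a l ih =>
    exact ⟨(hf a).1, (hf a).2, fun _ => hl a (by simp), hz.1, hz.2, by simp,
      ih fun a ha => hl a (by simp [ha])⟩

theorem Pstr'_eq {d m : ℕ} (B : Fin m → Fin d → Bool) :
    Pstr' B = outerSep d ++ ((ofFn B).map pStr').flatMap (· ++ outerSep d) := by
  simp [Pstr', flatMap_def, map_ofFn, Function.comp_def]

theorem Shalf'_eq {d n : ℕ} (A : Fin n → Fin d → Bool) :
    Shalf' A = ((ofFn A).flatMap fun a => [sStr' a, sStr' (zVec d)]).flatMap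
      (· ++ outerSep d) := by
  rw [flatMap_assoc]
  simp [Shalf', flatMap_def, map_ofFn, Function.comp_def]

theorem Sstr'_eq {d n : ℕ} (A : Fin n → Fin d → Bool) :
    Sstr' A = outerSep d ++ (sStr' (zVec d) ::
      ((ofFn A).flatMap (fun a => [sStr' a, sStr' (zVec d)]) ++
        ((ofFn A).flatMap (fun a => [sStr' a, sStr' (zVec d)]) ++ []))).flatMap
      (· ++ outerSep d) := by
  rw [flatMap_cons, flatMap_append, append_nil, ← Shalf'_eq, Sstr']
  simp only [append_assoc]

end SubstringLowerBound

open SubstringLowerBound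

/-- Let w = (d²+4d+1)(2m−1)+d+1. If no pair (aᵢ, bⱼ) is orthogonal, then every
substring T of S' containing P' as a subsequence has length at least w − 2d. -/
theorem substring_length_lower_bound' {d n m : ℕ} (hd : 1 ≤ d) (hn : 1 ≤ n)
    (hm : 1 ≤ m) (hmn : m ≤ n)
    (A : Fin n → Fin d → Bool) (B : Fin m → Fin d → Bool)
    (horth : ¬ ∃ (i : Fin n) (j : Fin m), Orthogonal (A i) (B j)) :
    ∀ T : List Bool, T <:+: Sstr' A → (Pstr' B).Sublist T →
      ((d ^ 2 + 4 * d + 1) * (2 * m - 1) + d + 1) - 2 * d ≤ T.length := by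
  intro T hT hs
  obtain ⟨X, hTX, hX⟩ := List.infix_iff_prefix_suffix.1 hT
  rw [Pstr'_eq] at hs
  rw [Sstr'_eq] at hX
  have hz := And.intro (length_sStr' (zVec d)) (count_true_sStr'_le (zVec d))
  have hbad : ∀ a ∈ List.ofFn A, ∀ p ∈ Set.range fun j => pStr' (B j), ¬ p.Sublist (sStr' a) := by
    rintro a ha _ ⟨j, rfl⟩
    obtain ⟨i, rfl⟩ := (List.mem_ofFn' _ _).1 ha
    exact not_sublist_of_not_orthogonal fun h => horth ⟨i, j, h⟩
  have halt (H) (hH : IsAlternating d (d ^ 2 + 3 * d) (Set.range fun j => pStr' (B j)) true H) :=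
    isAlternating_flatMap_append (fun a => ⟨length_sStr' a, count_true_sStr'_le a⟩) hz
      (List.ofFn A) hbad hH
  have hne : (List.ofFn B).map pStr' ≠ [] := by
    rw [← List.length_pos_iff]
    simpa using Nat.lt_of_lt_of_le Nat.zero_lt_one hm
  have hL : ∀ p ∈ (List.ofFn B).map pStr', p ∈ Set.range fun j => pStr' (B j) := by
    simp
  have hQ : ∃ q, ((List.ofFn B).map pStr').flatMap (· ++ outerSep d) = false :: q := by
    obtain ⟨p, L, h⟩ := List.exists_cons_of_ne_nil hne
    obtain ⟨j, hj⟩ := hL p (by simp [h])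
    obtain ⟨q, hq⟩ := pStr'_head hd (B j)
    rw [h, ← hj, List.flatMap_cons]
    simp only [hq]
    exact ⟨_, rfl⟩
  have hS : IsAlternating d (d ^ 2 + 3 * d) (Set.range fun j => pStr' (B j)) false
      (sStr' (zVec d) :: ((List.ofFn A).flatMap (fun a => [sStr' a, sStr' (zVec d)]) ++
        ((List.ofFn A).flatMap (fun a => [sStr' a, sStr' (zVec d)]) ++ []))) :=
    ⟨hz.1, hz.2, by simp, halt _ (halt [] trivial)⟩
  rcases suffix_flatMap_cases _ false hS (d + 1) (by omega) [] X (by simp) hX with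
    rfl | ⟨g, t, c, G, hg, ht, hG, rfl⟩
  · rw [List.prefix_nil.1 hTX] at hs
    simp [outerSep] at hs
  rcases outerSep_append_sublist hg (.inr hQ) hTX hs with ⟨h, -⟩ | ⟨T', rfl, hT', hs'⟩
  · obtain ⟨q, hq⟩ := hQ
    rw [hq] at h
    exact absurd h (by simp)
  have key := length_lower_bound_of_prefix
    (by rintro _ ⟨j, rfl⟩; exact pStr'_head hd (B j))
    (by rintro _ ⟨j, rfl⟩; exact pStr'_last hd (B j)) _ hL hne c G hG T' hT' hs'
  obtain ⟨m, rfl⟩ : ∃ e, m = e + 1 := ⟨m - 1, by omega⟩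
  have hc : (if c then 0 else d ^ 2 + 3 * d + d + 1) ≤ d ^ 2 + 3 * d + d + 1 := by
    split <;> omega
  have e1 : 2 * (m + 1) * (d ^ 2 + 3 * d + d + 1) =
      (d ^ 2 + 4 * d + 1) * (2 * (m + 1) - 1) + (d ^ 2 + 4 * d + 1) := by
    rw [show 2 * (m + 1) - 1 = 2 * m + 1 by omega]; ring
  simp only [List.length_map, List.length_ofFn, e1] at key
  simp only [List.length_append, List.length_replicate]
  omega
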